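/- Let n ≥ 2 be an integer, α ∈ [0,1), and let ℰ be a C^n-solution of the Goursat problem for the hyperbolic Ernst equation in D with data {ℰ0, ℰ1} satisfying the data assumptions. Fix k ∈ ℂ ∖ [0,1] and define U(x,y,k) = (1/(2 Re ℰ)) [[conj(ℰ_x), λ conj(ℰ_x)],[λ ℰ_x, ℰ_x]] and V(x,y,k) = (1/(2 Re ℰ)) [[conj(ℰ_y), λ^{-1} conj(ℰ_y)],[λ^{-1} ℰ_y, ℰ_y]] with λ = λ(x,y,k). Let Φ0(x,k) and Φ1(y,k) be the unique continuous solutions of Φ0(x,k) = I + ∫_0^x U(x',0,k)Φ0(x',k) dx' and Φ1(y,k) = I + ∫_0^y V(0,y',k)Φ1(y',k) dy'. Then the unique continuous function Φ(·,·,k) : D → ℂ^{2×2} satisfying Φ(x,y,k) = Φ0(x,k) + ∫_0^y V(x,y',k) Φ(x,y',k) dy' also satisfies the alternative Volterra equation Φ(x,y,k) = Φ1(y,k) + ∫_0^x U(x',y,k) Φ(x',y,k) dx' for all (x,y) ∈ D. -/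

import Mathlib

open Complex Set MeasureTheory Topology Filter ComplexConjugate

noncomputable section

/-- The triangle `D = {(x,y) : 0 ≤ x, 0 ≤ y, x + y < 1}`. -/
def TriD : Set (ℝ × ℝ) := {p | 0 ≤ p.1 ∧ 0 ≤ p.2 ∧ p.1 + p.2 < 1}

/-- Partial derivative in the first variable. -/
def pdx (f : ℝ → ℝ → ℂ) (x y : ℝ) : ℂ := deriv (fun t => f t y) x

/-- Partial derivative in the second variable. -/
def pdy (f : ℝ → ℝ → ℂ) (x y : ℝ) : ℂ := deriv (fun t => f x t) y

/-- Mixed second partial derivative. -/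
def pdxy (f : ℝ → ℝ → ℂ) (x y : ℝ) : ℂ := pdx (fun a b => pdy f a b) x y

/-- Partial derivative in the first variable (real valued). -/
def pdxR (f : ℝ → ℝ → ℝ) (x y : ℝ) : ℝ := deriv (fun t => f t y) x

/-- Partial derivative in the second variable (real valued). -/
def pdyR (f : ℝ → ℝ → ℝ) (x y : ℝ) : ℝ := deriv (fun t => f x t) y

/-- Mixed second partial derivative (real valued). -/
def pdxyR (f : ℝ → ℝ → ℝ) (x y : ℝ) : ℝ := pdxR (fun a b => pdyR f a b) x y

/-- The hyperbolic Ernst equation at a point. -/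
def ErnstEqAt (E : ℝ → ℝ → ℂ) (x y : ℝ) : Prop :=
  (((E x y).re : ℂ)) * (pdxy E x y - (pdx E x y + pdy E x y) / (2 * (1 - x - y))) =
    pdx E x y * pdy E x y

/-- The Euler–Darboux equation at a point. -/
def EulerDarbouxAt (V : ℝ → ℝ → ℝ) (x y : ℝ) : Prop :=
  pdxyR V x y - (pdxR V x y + pdyR V x y) / (2 * (1 - x - y)) = 0

/-- `λ(x,y,k) = √((k-(1-y))/(k-x))`, principal branch (`Re λ > 0` off the cut). -/
def lam (x y : ℝ) (k : ℂ) : ℂ := ((k - (1 - (y : ℂ))) / (k - (x : ℂ))) ^ (1/2 : ℂ)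

/-- The segment `[0,1]` inside `ℂ`. -/
def seg01 : Set ℂ := (fun t : ℝ => (t : ℂ)) '' Icc 0 1

/-- A `C^n`-solution of the Goursat problem for the hyperbolic Ernst equation in `D`
with data `{E0, E1}`, with regularity exponent `α`. -/
def ErnstSolutionWith (n : ℕ) (α : ℝ) (E : ℝ → ℝ → ℂ) (E0 E1 : ℝ → ℂ) : Prop :=
  ContinuousOn (fun p : ℝ × ℝ => E p.1 p.2) TriD ∧
  ContDiffOn ℝ n (fun p : ℝ × ℝ => E p.1 p.2) (interior TriD) ∧
  (∀ p ∈ interior TriD, ErnstEqAt E p.1 p.2) ∧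
  (∃ g : ℝ × ℝ → ℂ, ContinuousOn g TriD ∧
      ∀ p ∈ interior TriD, g p = ((p.1 ^ α : ℝ) : ℂ) * pdx E p.1 p.2) ∧
  (∃ g : ℝ × ℝ → ℂ, ContinuousOn g TriD ∧
      ∀ p ∈ interior TriD, g p = ((p.2 ^ α : ℝ) : ℂ) * pdy E p.1 p.2) ∧
  (∃ g : ℝ × ℝ → ℂ, ContinuousOn g TriD ∧
      ∀ p ∈ interior TriD, g p = ((p.1 ^ α * p.2 ^ α : ℝ) : ℂ) * pdxy E p.1 p.2) ∧
  (∀ x ∈ Ico (0:ℝ) 1, E x 0 = E0 x) ∧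
  (∀ y ∈ Ico (0:ℝ) 1, E 0 y = E1 y) ∧
  (∀ p ∈ TriD, 0 < (E p.1 p.2).re)

/-- A `C^n`-solution of the Goursat problem for the hyperbolic Ernst equation in `D`
(with regularity exponent `α` existentially quantified over `[0,1)`). -/
def ErnstSolution (n : ℕ) (E : ℝ → ℝ → ℂ) (E0 E1 : ℝ → ℂ) : Prop :=
  ∃ α ∈ Ico (0:ℝ) 1, ErnstSolutionWith n α E E0 E1

/-- A `C^n`-solution of the Goursat problem for the Euler–Darboux equation in `D`
with data `{V0, V1}`, with regularity exponent `α`. -/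
def EDSolutionWith (n : ℕ) (α : ℝ) (V : ℝ → ℝ → ℝ) (V0 V1 : ℝ → ℝ) : Prop :=
  ContinuousOn (fun p : ℝ × ℝ => V p.1 p.2) TriD ∧
  ContDiffOn ℝ n (fun p : ℝ × ℝ => V p.1 p.2) (interior TriD) ∧
  (∀ p ∈ interior TriD, EulerDarbouxAt V p.1 p.2) ∧
  (∃ g : ℝ × ℝ → ℝ, ContinuousOn g TriD ∧
      ∀ p ∈ interior TriD, g p = p.1 ^ α * pdxR V p.1 p.2) ∧
  (∃ g : ℝ × ℝ → ℝ, ContinuousOn g TriD ∧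
      ∀ p ∈ interior TriD, g p = p.2 ^ α * pdyR V p.1 p.2) ∧
  (∃ g : ℝ × ℝ → ℝ, ContinuousOn g TriD ∧
      ∀ p ∈ interior TriD, g p = p.1 ^ α * p.2 ^ α * pdxyR V p.1 p.2) ∧
  (∀ x ∈ Ico (0:ℝ) 1, V x 0 = V0 x) ∧
  (∀ y ∈ Ico (0:ℝ) 1, V 0 y = V1 y)

/-- A `C^n`-solution of the Goursat problem for the Euler–Darboux equation in `D`. -/
def EDSolution (n : ℕ) (V : ℝ → ℝ → ℝ) (V0 V1 : ℝ → ℝ) : Prop :=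
  ∃ α ∈ Ico (0:ℝ) 1, EDSolutionWith n α V V0 V1

/-- The data assumptions (1.5) on a single boundary datum for the Ernst equation. -/
def ErnstData (n : ℕ) (α : ℝ) (E0 : ℝ → ℂ) : Prop :=
  ContinuousOn E0 (Ico 0 1) ∧ ContDiffOn ℝ n E0 (Ioo 0 1) ∧
  (∃ g : ℝ → ℂ, ContinuousOn g (Ico 0 1) ∧
      ∀ x ∈ Ioo (0:ℝ) 1, g x = ((x ^ α : ℝ) : ℂ) * deriv E0 x) ∧
  E0 0 = 1 ∧ (∀ x ∈ Ico (0:ℝ) 1, 0 < (E0 x).re)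

/-- The data assumptions on a single boundary datum for the Euler–Darboux equation. -/
def EDData (n : ℕ) (α : ℝ) (V0 : ℝ → ℝ) : Prop :=
  ContinuousOn V0 (Ico 0 1) ∧ ContDiffOn ℝ n V0 (Ioo 0 1) ∧
  (∃ g : ℝ → ℝ, ContinuousOn g (Ico 0 1) ∧
      ∀ x ∈ Ioo (0:ℝ) 1, g x = x ^ α * deriv V0 x) ∧
  V0 0 = 0

/-- The matrix `U0(x,k)` of the x-part of the Lax pair, built from the boundary datum. -/
def U0mat (E0 : ℝ → ℂ) (x : ℝ) (k : ℂ) : Matrix (Fin 2) (Fin 2) ℂ :=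
  (1 / (2 * ((E0 x).re : ℂ))) •
    !![conj (deriv E0 x), lam x 0 k * conj (deriv E0 x);
       lam x 0 k * deriv E0 x, deriv E0 x]

/-- The matrix `U(x,y,k)` of the Lax pair. -/
def Umat (E : ℝ → ℝ → ℂ) (k : ℂ) (x y : ℝ) : Matrix (Fin 2) (Fin 2) ℂ :=
  (1 / (2 * ((E x y).re : ℂ))) •
    !![conj (pdx E x y), lam x y k * conj (pdx E x y);
       lam x y k * pdx E x y, pdx E x y]

/-- The matrix `V(x,y,k)` of the Lax pair. -/
def Vmat (E : ℝ → ℝ → ℂ) (k : ℂ) (x y : ℝ) : Matrix (Fin 2) (Fin 2) ℂ :=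
  (1 / (2 * ((E x y).re : ℂ))) •
    !![conj (pdy E x y), (lam x y k)⁻¹ * conj (pdy E x y);
       (lam x y k)⁻¹ * pdy E x y, pdy E x y]

section Volterra

variable {F : Type*} [NormedAddCommGroup F] [NormedSpace ℝ F]

/-- A Grönwall uniqueness principle, uniform over a compact parameter set, for a linear bound with
the integrable singularity `y ^ (-α)`. -/
lemma eq_zero_of_hasDerivAt_of_norm_le_rpow {K : Set ℝ} (hK : IsCompact K) {α C Y : ℝ}
    (hα : α < 1) {w w' : ℝ → ℝ → F}
    (hw : ContinuousOn (fun p : ℝ × ℝ => w p.1 p.2) (K ×ˢ Icc 0 Y))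
    (h0 : ∀ x ∈ K, w x 0 = 0)
    (hd : ∀ x ∈ K, ∀ y ∈ Ioo 0 Y, HasDerivAt (w x) (w' x y) y)
    (hb : ∀ y ∈ Ioo 0 Y, ∀ B, (∀ t ∈ K, ‖w t y‖ ≤ B) → ∀ x ∈ K, ‖w' x y‖ ≤ C * y ^ (-α) * B) :
    ∀ x ∈ K, ∀ y ∈ Ico 0 Y, w x y = 0 := by
  set L : ℝ → ℝ := fun y => C / (1 - α) * y ^ (1 - α) with hL
  have hα' : 0 < 1 - α := by linarith
  have hLc : Continuous L := by
    exact continuous_const.mul (Real.continuous_rpow_const hα'.le)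
  have hLd : ∀ y, 0 < y → HasDerivAt L (C * y ^ (-α)) y := by
    intro y hy
    have := (Real.hasDerivAt_rpow_const (x := y) (p := 1 - α) (Or.inl hy.ne')).const_mul
      (C / (1 - α))
    refine this.congr_deriv ?_
    rw [show 1 - α - 1 = -α by ring]
    field_simp
  have hL0 : L 0 = 0 := by simp [hL, Real.zero_rpow hα'.ne']
  suffices H : ∀ η : ℝ, 0 < η → ∀ x ∈ K, ∀ y ∈ Ico 0 Y, ‖w x y‖ < η * Real.exp (L y) by
    intro x hx y hy
    rw [← norm_le_zero_iff]
    refine le_of_forall_pos_le_add fun ε hε => ?_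
    have := H (ε / Real.exp (L y)) (by positivity) x hx y hy
    rw [div_mul_cancel₀ _ (Real.exp_pos _).ne'] at this
    linarith
  intro η hη x₀ hx₀ y₀ hy₀
  by_contra! hcon
  have hsub : K ×ˢ Icc 0 y₀ ⊆ K ×ˢ Icc 0 Y := prod_mono_right (Icc_subset_Icc_right hy₀.2.le)
  have hcomp : IsCompact ((K ×ˢ Icc 0 y₀) ∩
      {p : ℝ × ℝ | 0 ≤ ‖w p.1 p.2‖ - η * Real.exp (L p.2)}) := by
    refine (hK.prod isCompact_Icc).of_isClosed_subset ?_ inter_subset_left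
    refine ContinuousOn.preimage_isClosed_of_isClosed (t := Ici 0)
      (f := fun p : ℝ × ℝ => ‖w p.1 p.2‖ - η * Real.exp (L p.2)) ?_
      (hK.prod isCompact_Icc).isClosed isClosed_Ici
    exact (hw.mono hsub).norm.sub (by fun_prop)
  obtain ⟨⟨x₁, y₁⟩, ⟨⟨hx₁, hy₁⟩, hge⟩, hmin⟩ := hcomp.exists_isMinOn
    ⟨(x₀, y₀), ⟨hx₀, hy₀.1, le_rfl⟩, by simpa using hcon⟩ continuous_snd.continuousOn
  simp only [mem_ofPred_eq, sub_nonneg] at hx₁ hy₁ hge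
  have hy₁pos : 0 < y₁ := by
    rcases hy₁.1.eq_or_lt with h | h
    · rw [← h, h0 x₁ hx₁, norm_zero] at hge
      have := Real.exp_pos (L 0)
      nlinarith
    · exact h
  have hy₁Y : y₁ < Y := hy₁.2.trans_lt hy₀.2
  have hlt : ∀ t ∈ K, ∀ s, 0 ≤ s → s < y₁ → ‖w t s‖ ≤ η * Real.exp (L s) := by
    intro t ht s hs0 hs
    by_contra! hc
    have := hmin (a := (t, s)) ⟨⟨ht, hs0, hs.le.trans hy₁.2⟩, by
      simp only [mem_ofPred_eq]; linarith⟩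
    exact absurd this (not_le.mpr hs)
  have hwc : ContinuousOn (w x₁) (Icc 0 Y) :=
    hw.comp (f := fun s : ℝ => (x₁, s)) (by fun_prop) fun s hs => ⟨hx₁, hs⟩
  have key : ∀ b ∈ Ioo 0 y₁,
      ‖w x₁ y₁‖ ≤ ‖w x₁ b‖ + η * (Real.exp (L y₁) - Real.exp (L b)) := by
    intro b hbm
    refine image_norm_le_of_norm_deriv_right_le_deriv_boundary' (f := w x₁) (f' := w' x₁)
      (a := b) (b := y₁) (B := fun s => ‖w x₁ b‖ + η * (Real.exp (L s) - Real.exp (L b)))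
      (B' := fun s => η * (Real.exp (L s) * (C * s ^ (-α)))) ?_ ?_ ?_ ?_ ?_ ?_
      (right_mem_Icc.mpr hbm.2.le)
    · exact hwc.mono (Icc_subset_Icc hbm.1.le hy₁Y.le)
    · intro s hs
      exact (hd x₁ hx₁ s ⟨hbm.1.trans_le hs.1, hs.2.trans hy₁Y⟩).hasDerivWithinAt
    · simp
    · fun_prop
    · intro s hs
      have := (((hLd s (hbm.1.trans_le hs.1)).exp.sub_const (Real.exp (L b))).const_mul η).const_add
        ‖w x₁ b‖
      exact this.hasDerivWithinAt
    · intro s hs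
      have hs0 : 0 < s := hbm.1.trans_le hs.1
      refine (hb s ⟨hs0, hs.2.trans hy₁Y⟩ _ (fun t ht => hlt t ht s hs0.le hs.2) x₁ hx₁).trans ?_
      exact le_of_eq (by ring)
  have hlim : Tendsto (fun b => ‖w x₁ b‖ + η * (Real.exp (L y₁) - Real.exp (L b))) (𝓝[>] 0)
      (𝓝 (‖w x₁ 0‖ + η * (Real.exp (L y₁) - Real.exp (L 0)))) := by
    have h1 : Tendsto (w x₁) (𝓝[>] 0) (𝓝 (w x₁ 0)) :=
      ((hwc 0 ⟨le_rfl, hy₁pos.le.trans hy₁Y.le⟩).mono_of_mem_nhdsWithin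
        (Icc_mem_nhdsGT (hy₁pos.trans hy₁Y))).tendsto
    have h2 : Continuous fun b => η * (Real.exp (L y₁) - Real.exp (L b)) := by fun_prop
    exact h1.norm.add ((h2.tendsto 0).mono_left nhdsWithin_le_nhds)
  have hfin := ge_of_tendsto hlim (Filter.eventually_of_mem (Ioo_mem_nhdsGT hy₁pos) key)
  rw [h0 x₁ hx₁, hL0, norm_zero, Real.exp_zero] at hfin
  linarith

/-- A continuous function on a product of two intervals extends continuously to the plane. -/
lemma exists_continuous_extension_prod {β : Type*} [TopologicalSpace β] {a X b Y : ℝ}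
    (haX : a ≤ X) (hbY : b ≤ Y) {h : ℝ → ℝ → β}
    (hh : ContinuousOn (fun p : ℝ × ℝ => h p.1 p.2) (Icc a X ×ˢ Icc b Y)) :
    ∃ H : ℝ → ℝ → β, Continuous (fun p : ℝ × ℝ => H p.1 p.2) ∧
      ∀ t ∈ Icc a X, ∀ y ∈ Icc b Y, H t y = h t y := by
  refine ⟨fun t y => h (projIcc a X haX t) (projIcc b Y hbY y), ?_, ?_⟩
  · have : Continuous fun p : ℝ × ℝ =>
        (((projIcc a X haX p.1 : ℝ), (projIcc b Y hbY p.2 : ℝ)) : ℝ × ℝ) := by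
      fun_prop
    exact hh.comp_continuous this fun p => ⟨Subtype.prop _, Subtype.prop _⟩
  · intro t ht y hy
    simp [projIcc_of_mem haX ht, projIcc_of_mem hbY hy]

/-- Joint continuity of an integral depending on a parameter and on its upper endpoint. -/
lemma continuousOn_integral_prod {a X Y : ℝ} (haX : a ≤ X) (hY : 0 ≤ Y) {h : ℝ → ℝ → F}
    (hh : ContinuousOn (fun p : ℝ × ℝ => h p.1 p.2) (Icc a X ×ˢ Icc 0 Y)) :
    ContinuousOn (fun p : ℝ × ℝ => ∫ t in a..p.1, h t p.2) (Icc a X ×ˢ Icc 0 Y) := by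
  obtain ⟨H, hH, hHh⟩ := exists_continuous_extension_prod haX hY hh
  have hc : Continuous fun p : ℝ × ℝ => ∫ t in a..p.1, H t p.2 := by
    refine intervalIntegral.continuous_parametric_intervalIntegral_of_continuous
      (f := fun (p : ℝ × ℝ) t => H t p.2) ?_ continuous_fst
    exact hH.comp (f := fun q : (ℝ × ℝ) × ℝ => (q.2, q.1.2)) (by fun_prop)
  refine hc.continuousOn.congr fun p hp => ?_
  refine intervalIntegral.integral_congr fun t ht => ?_
  rw [uIcc_of_le hp.1.1] at ht
  exact (hHh t ⟨ht.1, ht.2.trans hp.1.2⟩ p.2 hp.2).symm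

/-- Differentiation of a parametric integral whose integrand has a jointly continuous partial
derivative. -/
lemma hasDerivAt_integral_of_continuousOn_deriv {a x Y₀ Y₁ : ℝ} (hax : a ≤ x) {h h' : ℝ → ℝ → F}
    (hh : ∀ y ∈ Ioo Y₀ Y₁, ContinuousOn (fun t => h t y) (Icc a x))
    (hd : ∀ t ∈ Icc a x, ∀ y ∈ Ioo Y₀ Y₁, HasDerivAt (h t) (h' t y) y)
    (hh' : ContinuousOn (fun p : ℝ × ℝ => h' p.1 p.2) (Icc a x ×ˢ Ioo Y₀ Y₁))
    {y : ℝ} (hy : y ∈ Ioo Y₀ Y₁) :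
    HasDerivAt (fun s => ∫ t in a..x, h t s) (∫ t in a..x, h' t y) y := by
  obtain ⟨c, hc1, hc2⟩ := exists_between hy.1
  obtain ⟨d, hd1, hd2⟩ := exists_between hy.2
  have hcd : Icc c d ⊆ Ioo Y₀ Y₁ := fun s hs => ⟨hc1.trans_le hs.1, hs.2.trans_lt hd2⟩
  obtain ⟨B, hB⟩ := (isCompact_Icc.prod isCompact_Icc).exists_bound_of_continuousOn
    (hh'.mono (prod_mono_right hcd))
  have hIoc : uIoc a x ⊆ Icc a x := by rw [uIoc_of_le hax]; exact Ioc_subset_Icc_self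
  have hmeas : ∀ f : ℝ → F, ContinuousOn f (Icc a x) →
      AEStronglyMeasurable f (volume.restrict (uIoc a x)) := fun f hf =>
    (hf.mono hIoc).aestronglyMeasurable measurableSet_uIoc
  have hh'y : ContinuousOn (fun t => h' t y) (Icc a x) :=
    hh'.comp (f := fun t : ℝ => (t, y)) (by fun_prop) fun t ht => ⟨ht, hy⟩
  refine (intervalIntegral.hasDerivAt_integral_of_dominated_loc_of_deriv_le
    (F := fun s t => h t s) (F' := fun s t => h' t s) (bound := fun _ => B) (s := Icc c d)
    (Icc_mem_nhds hc2 hd1) ?_ ?_ (hmeas _ hh'y) ?_ intervalIntegrable_const ?_).2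
  · filter_upwards [Ioo_mem_nhds hy.1 hy.2] with s hs using hmeas _ (hh s hs)
  · exact (hh y hy).intervalIntegrable_of_Icc hax
  · exact Eventually.of_forall fun t ht s hs => hB (t, s) ⟨hIoc ht, hs⟩
  · exact Eventually.of_forall fun t ht s hs => hd t (hIoc ht) s (hcd hs)

/-- If `Φ` solves `Φ_y = V Φ`, solves `Φ_x = U Φ` in integrated form on the line `y = 0`, and the
zero-curvature condition `U_y - V_x + [U, V] = 0` holds, then `Φ` solves `Φ_x = U Φ` in integrated
form on the whole rectangle. The functions `V` and `V_x` may have a singularity `y ^ (-α)`. -/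
lemma eq_add_integral_of_zero_curvature {𝔸 : Type*} [NormedRing 𝔸] [NormedAlgebra ℝ 𝔸]
    [CompleteSpace 𝔸] {a X Y α : ℝ} (haX : a ≤ X) (hα : α < 1)
    {U V Vx v vx Φ : ℝ → ℝ → 𝔸}
    (hΦ : ContinuousOn (fun p : ℝ × ℝ => Φ p.1 p.2) (Icc a X ×ˢ Icc 0 Y))
    (hU : ContinuousOn (fun p : ℝ × ℝ => U p.1 p.2) (Icc a X ×ˢ Icc 0 Y))
    (hv : ContinuousOn (fun p : ℝ × ℝ => v p.1 p.2) (Icc a X ×ˢ Icc 0 Y))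
    (hvx : ContinuousOn (fun p : ℝ × ℝ => vx p.1 p.2) (Icc a X ×ˢ Icc 0 Y))
    (hV : ∀ x ∈ Icc a X, ∀ y ∈ Ioo 0 Y, V x y = y ^ (-α) • v x y)
    (hVx : ∀ x ∈ Icc a X, ∀ y ∈ Ioo 0 Y, Vx x y = y ^ (-α) • vx x y)
    (hΦd : ∀ x ∈ Icc a X, ∀ y ∈ Ioo 0 Y, HasDerivAt (Φ x) (V x y * Φ x y) y)
    (hVd : ∀ x ∈ Icc a X, ∀ y ∈ Ioo 0 Y, HasDerivAt (fun t => V t y) (Vx x y) x)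
    (hUd : ∀ x ∈ Icc a X, ∀ y ∈ Ioo 0 Y,
      HasDerivAt (U x) (Vx x y + V x y * U x y - U x y * V x y) y)
    (h0 : ∀ x ∈ Icc a X, Φ x 0 = Φ a 0 + ∫ t in a..x, U t 0 * Φ t 0) :
    ∀ x ∈ Icc a X, ∀ y ∈ Ico 0 Y, Φ x y = Φ a y + ∫ t in a..x, U t y * Φ t y := by
  rcases lt_or_ge Y 0 with hY | hY
  · intro x _ y hy
    exact absurd (hy.1.trans_lt hy.2) hY.not_gt
  have ha : a ∈ Icc a X := left_mem_Icc.mpr haX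
  set Θ : ℝ → ℝ → 𝔸 := fun x y => Φ a y + ∫ t in a..x, U t y * Φ t y with hΘ
  have hΘc : ContinuousOn (fun p : ℝ × ℝ => Θ p.1 p.2) (Icc a X ×ˢ Icc 0 Y) := by
    refine ContinuousOn.add ?_
      (continuousOn_integral_prod (h := fun x y => U x y * Φ x y) haX hY (hU.mul hΦ))
    exact hΦ.comp (f := fun p : ℝ × ℝ => (a, p.2)) (by fun_prop) fun p hp => ⟨ha, hp.2⟩
  have hIoo : Icc a X ×ˢ Ioo 0 Y ⊆ Icc a X ×ˢ Icc 0 Y := prod_mono_right Ioo_subset_Icc_self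
  have hpow : ContinuousOn (fun p : ℝ × ℝ => p.2 ^ (-α)) (Icc a X ×ˢ Ioo 0 Y) :=
    continuousOn_snd.rpow_const fun p hp => Or.inl hp.2.1.ne'
  have hVc : ContinuousOn (fun p : ℝ × ℝ => V p.1 p.2) (Icc a X ×ˢ Ioo 0 Y) :=
    (hpow.smul (hv.mono hIoo)).congr fun p hp => hV p.1 hp.1 p.2 hp.2
  have hVxc : ContinuousOn (fun p : ℝ × ℝ => Vx p.1 p.2) (Icc a X ×ˢ Ioo 0 Y) :=
    (hpow.smul (hvx.mono hIoo)).congr fun p hp => hVx p.1 hp.1 p.2 hp.2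
  obtain ⟨C₁, hC₁⟩ := (isCompact_Icc.prod isCompact_Icc).exists_bound_of_continuousOn hv
  obtain ⟨C₂, hC₂⟩ := (isCompact_Icc.prod isCompact_Icc).exists_bound_of_continuousOn hvx
  have slice : ∀ {f : ℝ → ℝ → 𝔸} {s : Set ℝ},
      ContinuousOn (fun p : ℝ × ℝ => f p.1 p.2) (Icc a X ×ˢ s) → ∀ y ∈ s, ∀ x ∈ Icc a X,
      ContinuousOn (fun t => f t y) (Icc a x) := fun {f s} hf y hy x hx =>
    hf.comp (f := fun t : ℝ => (t, y)) (by fun_prop) fun t ht => ⟨⟨ht.1, ht.2.trans hx.2⟩, hy⟩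
  have main := eq_zero_of_hasDerivAt_of_norm_le_rpow (K := Icc a X) isCompact_Icc (α := α)
    (C := C₁ + C₂ * (X - a)) (Y := Y) hα (w := fun x y => Φ x y - Θ x y)
    (w' := fun x y => V x y * (Φ x y - Θ x y) - ∫ t in a..x, Vx t y * (Φ t y - Θ t y))
    (hΦ.sub hΘc) (fun x hx => sub_eq_zero.mpr (h0 x hx)) ?_ ?_
  · exact fun x hx y hy => sub_eq_zero.mp (main x hx y hy)
  · intro x hx y hy
    have hyc := Ioo_subset_Icc_self hy
    have hint : HasDerivAt (fun s => ∫ t in a..x, U t s * Φ t s)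
        (∫ t in a..x, (Vx t y + V t y * U t y) * Φ t y) y := by
      refine hasDerivAt_integral_of_continuousOn_deriv (h := fun t s => U t s * Φ t s)
        (h' := fun t s => (Vx t s + V t s * U t s) * Φ t s) hx.1 ?_ ?_ ?_ hy
      · intro s hs
        exact slice (f := fun x y => U x y * Φ x y) (hU.mul hΦ) s (Ioo_subset_Icc_self hs) x hx
      · intro t ht s hs
        have ht' : t ∈ Icc a X := ⟨ht.1, ht.2.trans hx.2⟩
        refine ((hUd t ht' s hs).mul (hΦd t ht' s hs)).congr_deriv ?_
        noncomm_ring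
      · exact ((hVxc.add (hVc.mul (hU.mono hIoo))).mul (hΦ.mono hIoo)).mono
          (prod_mono_left (Icc_subset_Icc_right hx.2))
    have hVU := (slice hVc y hy x hx).mul
      ((slice hU y hyc x hx).mul (slice hΦ y hyc x hx))
    have hi1 : IntervalIntegrable (fun t => Vx t y * Θ t y + V t y * (U t y * Φ t y)) volume a x :=
      (((slice hVxc y hy x hx).mul (slice hΘc y hyc x hx)).add hVU).intervalIntegrable_of_Icc hx.1
    have hi2 : IntervalIntegrable (fun t => Vx t y * (Φ t y - Θ t y)) volume a x :=
      ((slice hVxc y hy x hx).mul ((slice hΦ y hyc x hx).sub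
        (slice hΘc y hyc x hx))).intervalIntegrable_of_Icc hx.1
    have hftc : ∫ t in a..x, (Vx t y * Θ t y + V t y * (U t y * Φ t y)) =
        V x y * Θ x y - V a y * Θ a y := by
      refine intervalIntegral.integral_eq_sub_of_hasDerivAt_of_le (f := fun t => V t y * Θ t y) hx.1
        ((slice hVc y hy x hx).mul (slice hΘc y hyc x hx)) ?_ hi1
      intro t ht
      have hUΦ := slice (f := fun x y => U x y * Φ x y) (hU.mul hΦ) y hyc x hx
      have hΘd : HasDerivAt (fun r => Θ r y) (U t y * Φ t y) t := by
        refine (intervalIntegral.integral_hasDerivAt_right ?_ ?_ ?_).const_add (Φ a y)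
        · exact (hUΦ.mono (Icc_subset_Icc_right ht.2.le)).intervalIntegrable_of_Icc ht.1.le
        · exact (hUΦ.mono Ioo_subset_Icc_self).stronglyMeasurableAtFilter isOpen_Ioo t ht
        · exact hUΦ.continuousAt (Icc_mem_nhds ht.1 ht.2)
      exact (hVd t ⟨ht.1.le, ht.2.le.trans hx.2⟩ y hy).mul hΘd
    have hΘy : HasDerivAt (Θ x)
        (V a y * Φ a y + ∫ t in a..x, (Vx t y + V t y * U t y) * Φ t y) y :=
      (hΦd a ha y hy).add hint
    refine ((hΦd x hx y hy).sub hΘy).congr_deriv ?_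
    have hsplit : ∫ t in a..x, (Vx t y + V t y * U t y) * Φ t y =
        (V x y * Θ x y - V a y * Θ a y) + ∫ t in a..x, Vx t y * (Φ t y - Θ t y) := by
      rw [← hftc, ← intervalIntegral.integral_add hi1 hi2]
      refine intervalIntegral.integral_congr fun t _ => ?_
      noncomm_ring
    have hΘa : Θ a y = Φ a y := by simp [hΘ]
    rw [hsplit, hΘa]
    noncomm_ring
  · intro y hy B hB x hx
    have hyc := Ioo_subset_Icc_self hy
    have hy0 : 0 ≤ y ^ (-α) := Real.rpow_nonneg hy.1.le _
    have hB0 : 0 ≤ B := (norm_nonneg _).trans (hB a ha)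
    have hC20 : 0 ≤ C₂ := (norm_nonneg _).trans (hC₂ (a, y) ⟨ha, hyc⟩)
    have hsc : ∀ {c : 𝔸} {C : ℝ} {d : 𝔸}, ‖c‖ ≤ C → ‖d‖ ≤ B →
        ‖(y ^ (-α) • c) * d‖ ≤ y ^ (-α) * C * B := by
      intro c C d hc hd
      refine (norm_mul_le _ _).trans ?_
      rw [norm_smul, Real.norm_of_nonneg hy0]
      have hC0 : 0 ≤ C := (norm_nonneg _).trans hc
      gcongr
    have e1 : ‖V x y * (Φ x y - Θ x y)‖ ≤ y ^ (-α) * C₁ * B := by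
      rw [hV x hx y hy]
      exact hsc (hC₁ (x, y) ⟨hx, hyc⟩) (hB x hx)
    have e2 : ‖∫ t in a..x, Vx t y * (Φ t y - Θ t y)‖ ≤ y ^ (-α) * C₂ * B * |x - a| := by
      refine intervalIntegral.norm_integral_le_of_norm_le_const fun t ht => ?_
      rw [uIoc_of_le hx.1] at ht
      have ht' : t ∈ Icc a X := ⟨ht.1.le, ht.2.trans hx.2⟩
      rw [hVx t ht' y hy]
      exact hsc (hC₂ (t, y) ⟨ht', hyc⟩) (hB t ht')
    rw [abs_of_nonneg (by linarith [hx.1])] at e2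
    have e3 : y ^ (-α) * C₂ * B * (x - a) ≤ y ^ (-α) * C₂ * B * (X - a) := by
      gcongr
      exact hx.2
    calc _ ≤ _ := norm_sub_le _ _
      _ ≤ _ := add_le_add e1 (e2.trans e3)
      _ = _ := by ring

lemma intervalIntegrable_of_eq_rpow_smul {α Y : ℝ} (hα : α < 1) {h c : ℝ → F}
    (hc : ContinuousOn c (Ico 0 Y)) (h_eq : ∀ t ∈ Ioo 0 Y, h t = t ^ (-α) • c t)
    {y : ℝ} (hy : y ∈ Ico 0 Y) : IntervalIntegrable h volume 0 y := by
  have h1 : IntervalIntegrable (fun t : ℝ => t ^ (-α) • c t) volume 0 y := by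
    refine (intervalIntegral.intervalIntegrable_rpow' (by linarith)).smul_continuousOn (hc.mono ?_)
    rw [uIcc_of_le hy.1]
    exact fun t ht => ⟨ht.1, ht.2.trans_lt hy.2⟩
  refine h1.congr fun t ht => ?_
  rw [uIoc_of_le hy.1] at ht
  exact (h_eq t ⟨ht.1, ht.2.trans_lt hy.2⟩).symm

lemma hasDerivAt_integral_of_eq_rpow_smul [CompleteSpace F] {α Y : ℝ} (hα : α < 1) {h c : ℝ → F}
    (hc : ContinuousOn c (Ico 0 Y)) (h_eq : ∀ t ∈ Ioo 0 Y, h t = t ^ (-α) • c t)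
    {y : ℝ} (hy : y ∈ Ioo 0 Y) : HasDerivAt (fun s => ∫ t in (0 : ℝ)..s, h t) (h y) y := by
  have hcont : ContinuousOn h (Ioo 0 Y) :=
    ((continuousOn_id.rpow_const fun t ht => Or.inl ht.1.ne').smul
      (hc.mono Ioo_subset_Ico_self)).congr h_eq
  exact intervalIntegral.integral_hasDerivAt_right
    (intervalIntegrable_of_eq_rpow_smul hα hc h_eq ⟨hy.1.le, hy.2⟩)
    (hcont.stronglyMeasurableAtFilter isOpen_Ioo y hy) (hcont.continuousAt (Ioo_mem_nhds hy.1 hy.2))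

/-- Uniqueness for the linear equation `φ' = V φ` with a singularity `y ^ (-α)` at the origin. -/
lemma eqOn_of_hasDerivAt_rpow_smul {𝔸 : Type*} [NormedRing 𝔸] [NormedAlgebra ℝ 𝔸] {α Y : ℝ}
    (hα : α < 1) {V v φ ψ : ℝ → 𝔸} (hv : ContinuousOn v (Ico 0 Y))
    (hV : ∀ y ∈ Ioo 0 Y, V y = y ^ (-α) • v y)
    (hφ : ContinuousOn φ (Ico 0 Y)) (hψ : ContinuousOn ψ (Ico 0 Y)) (h0 : φ 0 = ψ 0)
    (hφd : ∀ y ∈ Ioo 0 Y, HasDerivAt φ (V y * φ y) y)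
    (hψd : ∀ y ∈ Ioo 0 Y, HasDerivAt ψ (V y * ψ y) y) : EqOn φ ψ (Ico 0 Y) := by
  intro y hy
  obtain ⟨Z, hZ1, hZ2⟩ := exists_between hy.2
  have hsub : Icc 0 Z ⊆ Ico 0 Y := fun t ht => ⟨ht.1, ht.2.trans_lt hZ2⟩
  have hsub' : Ioo 0 Z ⊆ Ioo 0 Y := Ioo_subset_Ioo_right hZ2.le
  obtain ⟨C, hC⟩ := isCompact_Icc.exists_bound_of_continuousOn (hv.mono hsub)
  refine sub_eq_zero.mp (eq_zero_of_hasDerivAt_of_norm_le_rpow (K := {0}) isCompact_singleton hα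
    (C := C) (Y := Z) (w := fun _ s => φ s - ψ s) (w' := fun _ s => V s * (φ s - ψ s))
    ?_ ?_ ?_ ?_ 0 rfl y ⟨hy.1, hZ1⟩)
  · exact ((hφ.sub hψ).mono hsub).comp continuousOn_snd fun p hp => hp.2
  · simp [h0]
  · intro _ _ s hs
    refine ((hφd s (hsub' hs)).sub (hψd s (hsub' hs))).congr_deriv ?_
    rw [mul_sub]
  · intro s hs B hB _ _
    have hs0 : 0 ≤ s ^ (-α) := Real.rpow_nonneg hs.1.le _
    have hvs := hC s (Ioo_subset_Icc_self hs)
    have hC0 : 0 ≤ C := (norm_nonneg _).trans hvs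
    rw [hV s (hsub' hs)]
    calc _ ≤ ‖s ^ (-α) • v s‖ * ‖φ s - ψ s‖ := norm_mul_le _ _
      _ ≤ s ^ (-α) * C * B := by
        rw [norm_smul, Real.norm_of_nonneg hs0]
        gcongr
        exact hB 0 rfl
      _ = _ := by ring

/-- A partial derivative that extends continuously to the edge `y = 0` is the derivative along that
edge. -/
lemma hasDerivAt_edge_of_continuousOn {f d : ℝ → ℝ → F} {S : Set (ℝ × ℝ)}
    (hS : S = {p | 0 < p.1 ∧ 0 ≤ p.2 ∧ p.1 + p.2 < 1})
    (hf : ContinuousOn (fun p : ℝ × ℝ => f p.1 p.2) S)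
    (hd : ContinuousOn (fun p : ℝ × ℝ => d p.1 p.2) S)
    (hfd : ∀ x y, 0 < x → 0 < y → x + y < 1 → HasDerivAt (fun t => f t y) (d x y) x)
    {x : ℝ} (hx : x ∈ Ioo (0 : ℝ) 1) : HasDerivAt (fun t => f t 0) (d x 0) x := by
  obtain ⟨z, hz1, hz2⟩ := exists_between hx.2
  have hmem : ∀ᶠ y : ℝ in 𝓝[>] 0, y ∈ Ioo 0 (1 - z) := Ioo_mem_nhdsGT (by linarith)
  have hbase : ∀ t ∈ Ioo 0 z, (t, (0 : ℝ)) ∈ S := by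
    intro t ht
    rw [hS]
    exact ⟨ht.1, le_rfl, by simpa using ht.2.trans hz2⟩
  refine hasDerivAt_of_tendstoLocallyUniformlyOn (l := 𝓝[>] (0 : ℝ)) (s := Ioo 0 z) isOpen_Ioo
    (f := fun y t => f t y) (f' := fun y t => d t y) (g' := fun t => d t 0) ?_ ?_ ?_ ⟨hx.1, hz1⟩
  · rw [tendstoLocallyUniformlyOn_iff_forall_tendsto]
    intro t ht
    have hF : Tendsto (fun q : ℝ × ℝ => d q.2 q.1) (𝓝[>] (0 : ℝ) ×ˢ 𝓝[Ioo 0 z] t)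
        (𝓝 (d t 0)) := by
      refine (hd (t, 0) (hbase t ht)).tendsto.comp (f := fun q : ℝ × ℝ => (q.2, q.1)) ?_
      refine tendsto_nhdsWithin_iff.mpr ⟨?_, ?_⟩
      · rw [nhds_prod_eq]
        exact (tendsto_snd.mono_right nhdsWithin_le_nhds).prodMk
          (tendsto_fst.mono_right nhdsWithin_le_nhds)
      · filter_upwards [prod_mem_prod hmem self_mem_nhdsWithin] with q hq
        rw [hS]
        exact ⟨hq.2.1, hq.1.1.le, by linarith [hq.1.2, hq.2.2]⟩
    have hg : Tendsto (fun q : ℝ × ℝ => d q.2 0) (𝓝[>] (0 : ℝ) ×ˢ 𝓝[Ioo 0 z] t)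
        (𝓝 (d t 0)) := by
      have hd0 : ContinuousOn (fun t => d t 0) (Ioo 0 z) :=
        hd.comp (f := fun t : ℝ => (t, (0 : ℝ))) (by fun_prop) hbase
      exact (hd0 t ht).tendsto.comp tendsto_snd
    exact (hg.prodMk_nhds hF).mono_right (nhds_le_uniformity _)
  · filter_upwards [hmem] with y hy t ht
    exact hfd t y ht.1 hy.1 (by linarith [hy.2, ht.2])
  · intro t ht
    refine (hf (t, 0) (hbase t ht)).tendsto.comp (f := fun y : ℝ => (t, y)) ?_
    refine tendsto_nhdsWithin_iff.mpr ⟨?_, ?_⟩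
    · exact ((Continuous.prodMk_right t).tendsto 0).mono_left nhdsWithin_le_nhds
    · filter_upwards [hmem] with y hy
      rw [hS]
      exact ⟨ht.1, hy.1.le, by linarith [hy.2, ht.2]⟩

end Volterra

section Lax

attribute [local instance] Matrix.linftyOpNormedRing Matrix.linftyOpNormedAlgebra

lemma Matrix.hasDerivAt_of_entries {A : ℝ → Matrix (Fin 2) (Fin 2) ℂ}
    {A' : Matrix (Fin 2) (Fin 2) ℂ} {t : ℝ}
    (h : ∀ i j, HasDerivAt (fun s => A s i j) (A' i j) t) : HasDerivAt A A' t := by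
  have key : HasDerivAt
      (fun s => ∑ i, ∑ j, A s i j • Matrix.single i j (1 : ℂ))
      (∑ i, ∑ j, A' i j • Matrix.single i j (1 : ℂ)) t :=
    HasDerivAt.fun_sum fun i _ => HasDerivAt.fun_sum fun j _ => (h i j).smul_const _
  have hsum : ∀ B : Matrix (Fin 2) (Fin 2) ℂ,
      ∑ i, ∑ j, B i j • Matrix.single i j (1 : ℂ) = B := by
    intro B
    conv_rhs => rw [Matrix.matrix_eq_sum_single B]
    simp [Matrix.smul_single]
  simpa only [hsum] using key

/-- The common shape of the two matrices of the Lax pair. -/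
def laxMat (f : ℝ) (e μ : ℂ) : Matrix (Fin 2) (Fin 2) ℂ :=
  (1 / (2 * (f : ℂ))) • !![conj e, μ * conj e; μ * e, e]

/-- The derivative of `laxMat f e μ` along a curve with velocity `(f', e', μ')`. -/
def laxMatDeriv (f f' : ℝ) (e e' μ μ' : ℂ) : Matrix (Fin 2) (Fin 2) ℂ :=
  -((f' : ℂ) / f) • laxMat f e μ + laxMat f e' μ +
    (1 / (2 * (f : ℂ))) • !![0, μ' * conj e; μ' * e, 0]

lemma laxMat_smul (r f : ℝ) (e μ : ℂ) : laxMat f (r • e) μ = r • laxMat f e μ := by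
  ext i j
  fin_cases i <;> fin_cases j <;> simp [laxMat] <;> ring

lemma laxMatDeriv_smul (r f f' : ℝ) (e e' μ μ' : ℂ) :
    laxMatDeriv f f' (r • e) (r • e') μ μ' = r • laxMatDeriv f f' e e' μ μ' := by
  rw [laxMatDeriv, laxMatDeriv, laxMat_smul, laxMat_smul]
  ext i j
  fin_cases i <;> fin_cases j <;> simp <;> ring

lemma hasDerivAt_laxMat {f : ℝ → ℝ} {e μ : ℝ → ℂ} {f' : ℝ} {e' μ' : ℂ} {t : ℝ}
    (hf : HasDerivAt f f' t) (he : HasDerivAt e e' t) (hμ : HasDerivAt μ μ' t) (h0 : f t ≠ 0) :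
    HasDerivAt (fun s => laxMat (f s) (e s) (μ s)) (laxMatDeriv (f t) f' (e t) e' (μ t) μ') t := by
  have h0' : (f t : ℂ) ≠ 0 := by exact_mod_cast h0
  have hc : HasDerivAt (fun s => 1 / (2 * (f s : ℂ)))
      (-((f' : ℂ) / f t) * (1 / (2 * (f t : ℂ)))) t := by
    have := (hf.ofReal_comp.const_mul (2 : ℂ)).inv (mul_ne_zero two_ne_zero h0')
    simp only [one_div]
    refine this.congr_deriv ?_
    field_simp
  have hē : HasDerivAt (fun s => conj (e s)) (conj e') t := he.star_conj
  refine Matrix.hasDerivAt_of_entries fun i j => ?_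
  fin_cases i <;> fin_cases j <;> simp only [laxMat, laxMatDeriv, Matrix.smul_apply,
    Matrix.add_apply, Fin.zero_eta, Fin.mk_one, Fin.isValue, Matrix.of_apply, Matrix.cons_val', Matrix.cons_val_zero,
    Matrix.cons_val_one, Matrix.cons_val_fin_one, smul_eq_mul]
  · exact (hc.fun_mul hē).congr_deriv (by ring)
  · exact (hc.fun_mul (hμ.fun_mul hē)).congr_deriv (by ring)
  · exact (hc.fun_mul (hμ.fun_mul he)).congr_deriv (by ring)
  · exact (hc.fun_mul he).congr_deriv (by ring)

lemma Matrix.continuousOn_of_entries {T : Type*} [TopologicalSpace T] {s : Set T}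
    {A : T → Matrix (Fin 2) (Fin 2) ℂ} (h : ∀ i j, ContinuousOn (fun t => A t i j) s) :
    ContinuousOn A s :=
  continuousOn_pi.mpr fun i => continuousOn_pi.mpr fun j => h i j

section Continuity

variable {T : Type*} [TopologicalSpace T] {s : Set T} {f f' : T → ℝ} {e e' μ μ' : T → ℂ}

lemma continuousOn_laxMat (hf : ContinuousOn f s) (he : ContinuousOn e s) (hμ : ContinuousOn μ s)
    (h0 : ∀ t ∈ s, f t ≠ 0) : ContinuousOn (fun t => laxMat (f t) (e t) (μ t)) s := by
  have hc : ContinuousOn (fun t => 1 / (2 * (f t : ℂ))) s := by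
    refine ContinuousOn.div (by fun_prop) (by fun_prop) fun t ht => ?_
    exact mul_ne_zero two_ne_zero (by exact_mod_cast h0 t ht)
  refine Matrix.continuousOn_of_entries fun i j => ?_
  fin_cases i <;> fin_cases j <;> simp [laxMat, -one_div] <;> fun_prop

lemma continuousOn_laxMatDeriv (hf : ContinuousOn f s) (hf' : ContinuousOn f' s)
    (he : ContinuousOn e s) (he' : ContinuousOn e' s) (hμ : ContinuousOn μ s)
    (hμ' : ContinuousOn μ' s) (h0 : ∀ t ∈ s, f t ≠ 0) :
    ContinuousOn (fun t => laxMatDeriv (f t) (f' t) (e t) (e' t) (μ t) (μ' t)) s := by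
  have h0' : ∀ t ∈ s, (f t : ℂ) ≠ 0 := fun t ht => by exact_mod_cast h0 t ht
  have hc : ContinuousOn (fun t => 1 / (2 * (f t : ℂ))) s :=
    ContinuousOn.div (by fun_prop) (by fun_prop) fun t ht => mul_ne_zero two_ne_zero (h0' t ht)
  have hq : ContinuousOn (fun t => -((f' t : ℂ) / f t)) s :=
    (ContinuousOn.div (by fun_prop) (by fun_prop) h0').neg
  refine ((hq.smul (continuousOn_laxMat hf he hμ h0)).add (continuousOn_laxMat hf he' hμ h0)).add
    (hc.smul (Matrix.continuousOn_of_entries fun i j => ?_))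
  fin_cases i <;> fin_cases j <;> simp <;> fun_prop

end Continuity

/-- The zero-curvature condition for the Lax pair, as an algebraic consequence of the Ernst
equation. Here `q = k - x`, `s = 1 - x - y`, and `a`, `b`, `d` stand for `ℰ_x`, `ℰ_y`, `ℰ_xy`. -/
lemma laxMatDeriv_eq_of_ernst {f s : ℝ} {a b d l q : ℂ} (hf : f ≠ 0) (hs : s ≠ 0) (hq : q ≠ 0)
    (hl : l ≠ 0) (hls : (s : ℂ) = q * (1 - l ^ 2))
    (hE : (f : ℂ) * (d - (a + b) / (2 * (s : ℂ))) = a * b) :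
    laxMatDeriv f b.re a d l (1 / (2 * l * q)) =
      laxMatDeriv f a.re b d l⁻¹ (-(1 / (2 * l * q))) +
        laxMat f b l⁻¹ * laxMat f a l - laxMat f a l * laxMat f b l⁻¹ := by
  have hf' : (f : ℂ) ≠ 0 := by exact_mod_cast hf
  have hs' : (s : ℂ) ≠ 0 := by exact_mod_cast hs
  have hE' : (f : ℂ) * (conj d - (conj a + conj b) / (2 * (s : ℂ))) = conj a * conj b := by
    simpa [Complex.conj_ofNat] using congrArg conj hE
  have hl2 : 1 - l ^ 2 ≠ 0 := by
    intro h
    rw [h, mul_zero] at hls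
    exact hs' hls
  have hd : d = a * b / f + (a + b) / (2 * (s : ℂ)) := by
    rw [← hE]; field_simp; ring
  have hd' : conj d = conj a * conj b / f + (conj a + conj b) / (2 * (s : ℂ)) := by
    rw [← hE']; field_simp; ring
  ext i j
  fin_cases i <;> fin_cases j <;>
    simp only [laxMat, laxMatDeriv, Matrix.smul_apply, Matrix.add_apply, Matrix.sub_apply,
      Matrix.mul_apply, Fin.sum_univ_two, Fin.zero_eta, Fin.mk_one, Fin.isValue, Matrix.of_apply,
      Matrix.cons_val', Matrix.cons_val_zero, Matrix.cons_val_one, Matrix.cons_val_fin_one,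
      smul_eq_mul, re_eq_add_conj] <;>
    first
    | (field_simp; ring1)
    | (rw [hd, hls]; field_simp; ring1)
    | (rw [hd', hls]; field_simp; ring1)

lemma mem_interior_TriD {x y : ℝ} (hx : 0 < x) (hy : 0 < y) (hxy : x + y < 1) :
    (x, y) ∈ interior TriD := by
  refine mem_interior.mpr ⟨{p | 0 < p.1 ∧ 0 < p.2 ∧ p.1 + p.2 < 1},
    fun p hp => ⟨hp.1.le, hp.2.1.le, hp.2.2⟩, ?_, hx, hy, hxy⟩
  exact (isOpen_lt continuous_const continuous_fst).inter
    ((isOpen_lt continuous_const continuous_snd).inter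
      (isOpen_lt (continuous_fst.add continuous_snd) continuous_const))

section SpectralRoot

variable {x y : ℝ} {k : ℂ}

lemma sub_ofReal_ne_zero_of_notMem_seg01 (hk : k ∉ seg01) (hx : x ∈ Icc (0 : ℝ) 1) :
    k - (x : ℂ) ≠ 0 := fun h => hk ⟨x, hx, (sub_eq_zero.mp h).symm⟩

lemma lam_base_mem_slitPlane (hk : k ∉ seg01) (h : (x, y) ∈ TriD) :
    (k - (1 - (y : ℂ))) / (k - (x : ℂ)) ∈ slitPlane := by
  obtain ⟨hx, hy, hxy⟩ : 0 ≤ x ∧ 0 ≤ y ∧ x + y < 1 := h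
  have hq : k - (x : ℂ) ≠ 0 := sub_ofReal_ne_zero_of_notMem_seg01 hk ⟨hx, by linarith⟩
  by_contra hcon
  obtain ⟨hre, him⟩ : ((k - (1 - (y : ℂ))) / (k - (x : ℂ))).re ≤ 0 ∧
      ((k - (1 - (y : ℂ))) / (k - (x : ℂ))).im = 0 := by
    simpa [mem_slitPlane_iff, not_or] using hcon
  set r : ℝ := ((k - (1 - (y : ℂ))) / (k - (x : ℂ))).re with hr
  have hz : (k - (1 - (y : ℂ))) / (k - (x : ℂ)) = (r : ℂ) := Complex.ext rfl (by simpa using him)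
  rw [div_eq_iff hq] at hz
  have h1r : 0 < 1 - r := by linarith
  have h1r' : (1 - r : ℂ) ≠ 0 := by exact_mod_cast h1r.ne'
  refine hk ⟨(1 - y - r * x) / (1 - r), ⟨?_, ?_⟩, ?_⟩
  · refine div_nonneg ?_ h1r.le
    nlinarith
  · rw [div_le_one h1r]
    nlinarith
  · push_cast
    rw [div_eq_iff h1r']
    linear_combination -hz

lemma lam_ne_zero (hk : k ∉ seg01) (h : (x, y) ∈ TriD) : lam x y k ≠ 0 := by
  rw [lam, Ne, cpow_eq_zero_iff]
  exact fun hc => slitPlane_ne_zero (lam_base_mem_slitPlane hk h) hc.1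

lemma lam_sq : lam x y k ^ 2 = (k - (1 - (y : ℂ))) / (k - (x : ℂ)) := by
  rw [lam, ← cpow_nat_mul]
  norm_num

lemma hasDerivAt_sqrt_comp {z : ℝ → ℂ} {z' : ℂ} {t : ℝ} (hz : HasDerivAt z z' t)
    (h : z t ∈ slitPlane) :
    HasDerivAt (fun s => z s ^ (1 / 2 : ℂ)) (z' / (2 * z t ^ (1 / 2 : ℂ))) t := by
  have hne := slitPlane_ne_zero h
  have h1 : HasDerivAt (fun w : ℂ => w ^ (1 / 2 : ℂ)) (1 / 2 * z t ^ (1 / 2 - 1 : ℂ) * 1) (z t) :=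
    (hasDerivAt_id (z t)).cpow_const h
  refine (h1.comp t hz).congr_deriv ?_
  have hsq : (z t ^ (1 / 2 : ℂ)) ^ 2 = z t := by
    rw [← cpow_nat_mul]
    norm_num
  have hl : z t ^ (1 / 2 : ℂ) ≠ 0 := fun hc => hne (by rw [← hsq, hc]; simp)
  rw [cpow_sub _ _ hne, cpow_one]
  field_simp
  linear_combination z' * hsq

lemma hasDerivAt_lam_right (hk : k ∉ seg01) (h : (x, y) ∈ TriD) :
    HasDerivAt (fun s => lam x s k) (1 / (2 * lam x y k * (k - (x : ℂ)))) y := by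
  have hz : HasDerivAt (fun s : ℝ => (k - (1 - (s : ℂ))) / (k - (x : ℂ))) (1 / (k - (x : ℂ))) y := by
    have := ((((hasDerivAt_id y).ofReal_comp).const_sub (1 : ℂ)).const_sub k).div_const (k - (x : ℂ))
    simpa using this
  refine (hasDerivAt_sqrt_comp hz (lam_base_mem_slitPlane hk h)).congr_deriv ?_
  change 1 / (k - (x : ℂ)) / (2 * lam x y k) = _
  rw [div_div, mul_comm (k - (x : ℂ))]

lemma hasDerivAt_lam_inv_left (hk : k ∉ seg01) (h : (x, y) ∈ TriD) :
    HasDerivAt (fun s => (lam s y k)⁻¹) (-(1 / (2 * lam x y k * (k - (x : ℂ))))) x := by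
  have hq : k - (x : ℂ) ≠ 0 := sub_ofReal_ne_zero_of_notMem_seg01 hk
    ⟨h.1, by linarith [h.2.1, h.2.2]⟩
  have hl := lam_ne_zero hk h
  have hz : HasDerivAt (fun s : ℝ => (k - (1 - (y : ℂ))) / (k - (s : ℂ)))
      (lam x y k ^ 2 / (k - (x : ℂ))) x := by
    have := (hasDerivAt_const x (k - (1 - (y : ℂ)))).fun_div
      (((hasDerivAt_id x).ofReal_comp).const_sub k) hq
    refine this.congr_deriv ?_
    rw [lam_sq]
    simp only [id, ofReal_one]
    field_simp
    ring
  refine ((hasDerivAt_sqrt_comp hz (lam_base_mem_slitPlane hk h)).fun_inv hl).congr_deriv ?_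
  change -(lam x y k ^ 2 / (k - (x : ℂ)) / (2 * lam x y k)) / lam x y k ^ 2 = _
  field_simp

lemma continuousOn_lam (hk : k ∉ seg01) :
    ContinuousOn (fun p : ℝ × ℝ => lam p.1 p.2 k) TriD := by
  refine ContinuousOn.cpow_const ?_ fun p hp => lam_base_mem_slitPlane hk hp
  refine ContinuousOn.div (by fun_prop) (by fun_prop) fun p hp => ?_
  exact sub_ofReal_ne_zero_of_notMem_seg01 hk ⟨hp.1, by linarith [hp.2.1, hp.2.2]⟩

end SpectralRoot

section Partials

variable {E : ℝ → ℝ → ℂ} {x y : ℝ}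

lemma hasDerivAt_pdx (h : DifferentiableAt ℝ (fun p : ℝ × ℝ => E p.1 p.2) (x, y)) :
    HasDerivAt (fun t => E t y) (pdx E x y) x := by
  have h1 : HasDerivAt (fun t : ℝ => (t, y)) ((1 : ℝ), (0 : ℝ)) x :=
    (hasDerivAt_id x).prodMk (hasDerivAt_const x y)
  exact (h.hasFDerivAt.comp_hasDerivAt x h1).differentiableAt.hasDerivAt

lemma hasDerivAt_pdy (h : DifferentiableAt ℝ (fun p : ℝ × ℝ => E p.1 p.2) (x, y)) :
    HasDerivAt (fun t => E x t) (pdy E x y) y := by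
  have h1 : HasDerivAt (fun t : ℝ => (x, t)) ((0 : ℝ), (1 : ℝ)) y :=
    (hasDerivAt_const y x).prodMk (hasDerivAt_id y)
  exact (h.hasFDerivAt.comp_hasDerivAt y h1).differentiableAt.hasDerivAt

lemma pdx_eq_fderiv (h : DifferentiableAt ℝ (fun p : ℝ × ℝ => E p.1 p.2) (x, y)) :
    pdx E x y = fderiv ℝ (fun p : ℝ × ℝ => E p.1 p.2) (x, y) (1, 0) := by
  have h1 : HasDerivAt (fun t : ℝ => (t, y)) ((1 : ℝ), (0 : ℝ)) x :=
    (hasDerivAt_id x).prodMk (hasDerivAt_const x y)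
  exact (h.hasFDerivAt.comp_hasDerivAt x h1).deriv

lemma pdy_eq_fderiv (h : DifferentiableAt ℝ (fun p : ℝ × ℝ => E p.1 p.2) (x, y)) :
    pdy E x y = fderiv ℝ (fun p : ℝ × ℝ => E p.1 p.2) (x, y) (0, 1) := by
  have h1 : HasDerivAt (fun t : ℝ => (x, t)) ((0 : ℝ), (1 : ℝ)) y :=
    (hasDerivAt_const y x).prodMk (hasDerivAt_id y)
  exact (h.hasFDerivAt.comp_hasDerivAt y h1).deriv

lemma hasDerivAt_pdy_pdxy_and_pdx_pdxy
    (h : ContDiffAt ℝ 2 (fun p : ℝ × ℝ => E p.1 p.2) (x, y)) :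
    HasDerivAt (fun t => pdy E t y) (pdxy E x y) x ∧
      HasDerivAt (fun t => pdx E x t) (pdxy E x y) y := by
  set G : ℝ × ℝ → ℂ := fun p => E p.1 p.2 with hG
  have hev : ∀ᶠ p : ℝ × ℝ in 𝓝 (x, y), DifferentiableAt ℝ G p := by
    filter_upwards [h.eventually (by simp)] with p hp using hp.differentiableAt (by simp)
  have hF : HasFDerivAt (fderiv ℝ G) (fderiv ℝ (fderiv ℝ G) (x, y)) (x, y) :=
    ((h.fderiv_right (m := 1) (by norm_num)).differentiableAt (by simp)).hasFDerivAt
  have hsymm : IsSymmSndFDerivAt ℝ G (x, y) := h.isSymmSndFDerivAt (by simp)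
  have hcx : HasDerivAt (fun t : ℝ => (t, y)) ((1 : ℝ), (0 : ℝ)) x :=
    (hasDerivAt_id x).prodMk (hasDerivAt_const x y)
  have hcy : HasDerivAt (fun t : ℝ => (x, t)) ((0 : ℝ), (1 : ℝ)) y :=
    (hasDerivAt_const y x).prodMk (hasDerivAt_id y)
  have hyx : HasDerivAt (fun t => pdy E t y) (fderiv ℝ (fderiv ℝ G) (x, y) (1, 0) (0, 1)) x := by
    have h1 : HasDerivAt (fun t => fderiv ℝ G (t, y)) (fderiv ℝ (fderiv ℝ G) (x, y) (1, 0)) x :=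
      hF.comp_hasDerivAt x hcx
    refine HasDerivAt.congr_of_eventuallyEq ((ContinuousLinearMap.apply ℝ ℂ
      ((0 : ℝ), (1 : ℝ))).hasFDerivAt.comp_hasDerivAt x h1) ?_
    filter_upwards [hcx.continuousAt.tendsto.eventually hev] with t ht using pdy_eq_fderiv ht
  have hxy : HasDerivAt (fun t => pdx E x t) (fderiv ℝ (fderiv ℝ G) (x, y) (0, 1) (1, 0)) y := by
    have h1 : HasDerivAt (fun t => fderiv ℝ G (x, t)) (fderiv ℝ (fderiv ℝ G) (x, y) (0, 1)) y :=
      hF.comp_hasDerivAt y hcy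
    refine HasDerivAt.congr_of_eventuallyEq ((ContinuousLinearMap.apply ℝ ℂ
      ((1 : ℝ), (0 : ℝ))).hasFDerivAt.comp_hasDerivAt y h1) ?_
    filter_upwards [hcy.continuousAt.tendsto.eventually hev] with t ht using pdx_eq_fderiv ht
  have hval : pdxy E x y = fderiv ℝ (fderiv ℝ G) (x, y) (1, 0) (0, 1) := hyx.deriv
  rw [hval]
  exact ⟨hyx, hxy.congr_deriv (hsymm (0, 1) (1, 0))⟩

end Partials

/-- On the triangle, away from `x = 0`, the partial derivative `E_x` is `x ^ (-α)` times the
continuous extension of `x ^ α E_x`. -/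
lemma pdx_eq_rpow_smul {E : ℝ → ℝ → ℂ} {g : ℝ × ℝ → ℂ} {α : ℝ}
    (hE : ContinuousOn (fun p : ℝ × ℝ => E p.1 p.2) TriD) (hg : ContinuousOn g TriD)
    (hd : ∀ x y, 0 < x → 0 < y → x + y < 1 → HasDerivAt (fun t => E t y) (pdx E x y) x)
    (hgE : ∀ x y, 0 < x → 0 < y → x + y < 1 → g (x, y) = ((x ^ α : ℝ) : ℂ) * pdx E x y)
    {x y : ℝ} (hx : 0 < x) (hy : 0 ≤ y) (hxy : x + y < 1) :
    pdx E x y = x ^ (-α) • g (x, y) := by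
  have hint : ∀ x y, 0 < x → 0 < y → x + y < 1 → pdx E x y = x ^ (-α) • g (x, y) := by
    intro x y hx hy hxy
    rw [hgE x y hx hy hxy, ← real_smul, smul_smul, ← Real.rpow_add hx]
    simp
  rcases hy.eq_or_lt with rfl | hy
  · have hsub : {p : ℝ × ℝ | 0 < p.1 ∧ 0 ≤ p.2 ∧ p.1 + p.2 < 1} ⊆ TriD :=
      fun p hp => ⟨hp.1.le, hp.2⟩
    refine (hasDerivAt_edge_of_continuousOn (f := E) (d := fun x y => x ^ (-α) • g (x, y)) rfl
      (hE.mono hsub) ?_ ?_ ⟨hx, by simpa using hxy⟩).deriv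
    · exact (continuousOn_fst.rpow_const fun p hp => Or.inl hp.1.ne').smul (hg.mono hsub)
    · exact fun x y hx hy hxy => (hd x y hx hy hxy).congr_deriv (hint x y hx hy hxy)
  · exact hint x y hx hy hxy

lemma Matrix.intervalIntegral_apply {M : ℝ → Matrix (Fin 2) (Fin 2) ℂ} {a b : ℝ}
    (hM : @IntervalIntegrable _ PseudoMetricSpace.toUniformSpace.toTopologicalSpace _ M volume a b)
    (i j : Fin 2) :
    (∫ t in a..b, M t) i j = ∫ t in a..b, M t i j :=
  (ContinuousLinearMap.intervalIntegral_comp_comm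
    (LinearMap.toContinuousLinearMap (Matrix.entryLinearMap ℝ ℂ i j)) hM).symm

lemma Matrix.eq_add_intervalIntegral_iff {A B : Matrix (Fin 2) (Fin 2) ℂ}
    {M : ℝ → Matrix (Fin 2) (Fin 2) ℂ} {a b : ℝ}
    (hM : @IntervalIntegrable _ PseudoMetricSpace.toUniformSpace.toTopologicalSpace _ M volume a b) :
    A = B + ∫ t in a..b, M t ↔ ∀ i j, A i j = B i j + ∫ t in a..b, M t i j := by
  rw [← Matrix.ext_iff]
  simp only [Matrix.add_apply, Matrix.intervalIntegral_apply hM]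

lemma hasDerivAt_re {f : ℝ → ℂ} {f' : ℂ} {t : ℝ} (h : HasDerivAt f f' t) :
    HasDerivAt (fun s => (f s).re) f'.re t :=
  reCLM.hasFDerivAt.comp_hasDerivAt t h

lemma Umat_eq_laxMat (E : ℝ → ℝ → ℂ) (k : ℂ) (x y : ℝ) :
    Umat E k x y = laxMat (E x y).re (pdx E x y) (lam x y k) := rfl

lemma Vmat_eq_laxMat (E : ℝ → ℝ → ℂ) (k : ℂ) (x y : ℝ) :
    Vmat E k x y = laxMat (E x y).re (pdy E x y) (lam x y k)⁻¹ := rfl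

/-- The derivative `V_x` of the second matrix of the Lax pair. -/
def VmatX (E : ℝ → ℝ → ℂ) (k : ℂ) (x y : ℝ) : Matrix (Fin 2) (Fin 2) ℂ :=
  laxMatDeriv (E x y).re (pdx E x y).re (pdy E x y) (pdxy E x y) (lam x y k)⁻¹
    (-(1 / (2 * lam x y k * (k - (x : ℂ)))))

section LaxPair

variable {E : ℝ → ℝ → ℂ} {k : ℂ} {x y : ℝ}

lemma hasDerivAt_Vmat (hk : k ∉ seg01) (h : (x, y) ∈ TriD) (hre : 0 < (E x y).re)
    (hE : ContDiffAt ℝ 2 (fun p : ℝ × ℝ => E p.1 p.2) (x, y)) :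
    HasDerivAt (fun t => Vmat E k t y) (VmatX E k x y) x :=
  hasDerivAt_laxMat (hasDerivAt_re (hasDerivAt_pdx (hE.differentiableAt (by simp))))
    (hasDerivAt_pdy_pdxy_and_pdx_pdxy hE).1 (hasDerivAt_lam_inv_left hk h) hre.ne'

lemma hasDerivAt_Umat (hk : k ∉ seg01) (h : (x, y) ∈ TriD) (hre : 0 < (E x y).re)
    (hE : ContDiffAt ℝ 2 (fun p : ℝ × ℝ => E p.1 p.2) (x, y)) (hErnst : ErnstEqAt E x y) :
    HasDerivAt (Umat E k x)
      (VmatX E k x y + Vmat E k x y * Umat E k x y - Umat E k x y * Vmat E k x y) y := by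
  have hq : k - (x : ℂ) ≠ 0 := sub_ofReal_ne_zero_of_notMem_seg01 hk
    ⟨h.1, by linarith [h.2.1, h.2.2]⟩
  have hs : 1 - x - y ≠ 0 := by
    have : x + y < 1 := h.2.2
    exact (by linarith : 0 < 1 - x - y).ne'
  refine (hasDerivAt_laxMat (hasDerivAt_re (hasDerivAt_pdy (hE.differentiableAt (by simp))))
    (hasDerivAt_pdy_pdxy_and_pdx_pdxy hE).2 (hasDerivAt_lam_right hk h) hre.ne').congr_deriv ?_
  refine laxMatDeriv_eq_of_ernst hre.ne' hs hq (lam_ne_zero hk h) ?_ ?_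
  · rw [lam_sq]
    push_cast
    field_simp
    ring
  · have := hErnst
    rw [ErnstEqAt] at this
    push_cast
    exact this

end LaxPair

/-- A solution of the Volterra equation in `y` whose initial values on `y = 0` solve the `x`-equation
also solves the Volterra equation in `x`. -/
lemma eq_add_integral_Umat {n : ℕ} (hn : 2 ≤ n) {α : ℝ} (hα : α < 1) {E0 E1 : ℝ → ℂ}
    {E : ℝ → ℝ → ℂ} (hE : ErnstSolutionWith n α E E0 E1) {k : ℂ} (hk : k ∉ seg01)
    {Φ0 Φ1 : ℝ → Matrix (Fin 2) (Fin 2) ℂ}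
    (hΦ0eq : ∀ x ∈ Ico (0:ℝ) 1, ∀ i j, Φ0 x i j =
      (1 : Matrix (Fin 2) (Fin 2) ℂ) i j + ∫ t in (0:ℝ)..x, (Umat E k t 0 * Φ0 t) i j)
    (hΦ1c : ContinuousOn Φ1 (Ico 0 1))
    (hΦ1eq : ∀ y ∈ Ico (0:ℝ) 1, ∀ i j, Φ1 y i j =
      (1 : Matrix (Fin 2) (Fin 2) ℂ) i j + ∫ t in (0:ℝ)..y, (Vmat E k 0 t * Φ1 t) i j)
    {Φ : ℝ → ℝ → Matrix (Fin 2) (Fin 2) ℂ}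
    (hΦc : ContinuousOn (fun p : ℝ × ℝ => Φ p.1 p.2) TriD)
    (hΦeq : ∀ p ∈ TriD, ∀ i j, Φ p.1 p.2 i j =
      Φ0 p.1 i j + ∫ t in (0:ℝ)..p.2, (Vmat E k p.1 t * Φ p.1 t) i j) :
    ∀ p ∈ TriD, ∀ i j, Φ p.1 p.2 i j =
      Φ1 p.2 i j + ∫ t in (0:ℝ)..p.1, (Umat E k t p.2 * Φ t p.2) i j := by
  obtain ⟨hEc, hEn, hErnst, ⟨g₁, hg₁c, hg₁⟩, ⟨g₂, hg₂c, hg₂⟩, ⟨g₃, hg₃c, hg₃⟩, -, -, hpos⟩ := hE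
  have hC2 : ∀ x y, 0 < x → 0 < y → x + y < 1 →
      ContDiffAt ℝ 2 (fun p : ℝ × ℝ => E p.1 p.2) (x, y) := fun x y hx hy hxy =>
    (hEn.contDiffAt (isOpen_interior.mem_nhds (mem_interior_TriD hx hy hxy))).of_le
      (by exact_mod_cast hn)
  have hdiff : ∀ x y, 0 < x → 0 < y → x + y < 1 →
      DifferentiableAt ℝ (fun p : ℝ × ℝ => E p.1 p.2) (x, y) := fun x y hx hy hxy =>
    (hC2 x y hx hy hxy).differentiableAt (by simp)
  have hpdx : ∀ x y, 0 < x → 0 ≤ y → x + y < 1 → pdx E x y = x ^ (-α) • g₁ (x, y) :=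
    fun x y hx hy hxy => pdx_eq_rpow_smul hEc hg₁c
      (fun x y hx hy hxy => hasDerivAt_pdx (hdiff x y hx hy hxy))
      (fun x y hx hy hxy => hg₁ _ (mem_interior_TriD hx hy hxy)) hx hy hxy
  have hswap : MapsTo Prod.swap TriD TriD := fun p hp =>
    ⟨hp.2.1, hp.1, by simpa [add_comm] using hp.2.2⟩
  have hpdy : ∀ x y, 0 ≤ x → 0 < y → x + y < 1 → pdy E x y = y ^ (-α) • g₂ (x, y) :=
    fun x y hx hy hxy => pdx_eq_rpow_smul (E := fun a b => E b a) (g := g₂ ∘ Prod.swap)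
      (hEc.comp continuous_swap.continuousOn hswap) (hg₂c.comp continuous_swap.continuousOn hswap)
      (fun x y hx hy hxy => hasDerivAt_pdy (hdiff y x hy hx (by linarith)))
      (fun x y hx hy hxy => hg₂ _ (mem_interior_TriD hy hx (by linarith))) hy hx (by linarith)
  have hpdxy : ∀ x y, 0 < x → 0 < y → x + y < 1 →
      pdxy E x y = y ^ (-α) • x ^ (-α) • g₃ (x, y) := by
    intro x y hx hy hxy
    rw [hg₃ _ (mem_interior_TriD hx hy hxy), ← real_smul, smul_smul, smul_smul]
    have h1 : y ^ (-α) * (x ^ (-α) * (x ^ α * y ^ α)) = 1 := by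
      rw [Real.rpow_neg hx.le, Real.rpow_neg hy.le]
      have := (Real.rpow_pos_of_pos hx α).ne'
      have := (Real.rpow_pos_of_pos hy α).ne'
      field_simp
    simp only [mul_assoc] at h1 ⊢
    rw [h1, one_smul]
  have hre : ContinuousOn (fun p : ℝ × ℝ => (E p.1 p.2).re) TriD :=
    continuous_re.comp_continuousOn hEc
  have hre0 : ∀ p ∈ TriD, (E p.1 p.2).re ≠ 0 := fun p hp => (hpos p hp).ne'
  have hlam := continuousOn_lam hk
  have hlam0 : ∀ p ∈ TriD, lam p.1 p.2 k ≠ 0 := fun p hp => lam_ne_zero hk hp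
  set u : ℝ → ℝ → Matrix (Fin 2) (Fin 2) ℂ :=
    fun x y => laxMat (E x y).re (g₁ (x, y)) (lam x y k) with hu
  set v : ℝ → ℝ → Matrix (Fin 2) (Fin 2) ℂ :=
    fun x y => laxMat (E x y).re (g₂ (x, y)) (lam x y k)⁻¹ with hv
  have huc : ContinuousOn (fun p : ℝ × ℝ => u p.1 p.2) TriD :=
    continuousOn_laxMat hre hg₁c hlam hre0
  have hvc : ContinuousOn (fun p : ℝ × ℝ => v p.1 p.2) TriD :=
    continuousOn_laxMat hre hg₂c (hlam.inv₀ hlam0) hre0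
  have hUu : ∀ x y, 0 < x → 0 ≤ y → x + y < 1 → Umat E k x y = x ^ (-α) • u x y := by
    intro x y hx hy hxy
    rw [Umat_eq_laxMat, hpdx x y hx hy hxy, laxMat_smul]
  have hVv : ∀ x y, 0 ≤ x → 0 < y → x + y < 1 → Vmat E k x y = y ^ (-α) • v x y := by
    intro x y hx hy hxy
    rw [Vmat_eq_laxMat, hpdy x y hx hy hxy, laxMat_smul]
  have horiz : ∀ {f : ℝ → ℝ → Matrix (Fin 2) (Fin 2) ℂ},
      ContinuousOn (fun p : ℝ × ℝ => f p.1 p.2) TriD → ∀ y, 0 ≤ y →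
      ContinuousOn (fun t => f t y) (Ico 0 (1 - y)) := fun {f} hf y hy =>
    hf.comp (f := fun t : ℝ => (t, y)) (by fun_prop)
      fun t ht => ⟨ht.1, hy, by linarith [ht.2]⟩
  have vert : ∀ {f : ℝ → ℝ → Matrix (Fin 2) (Fin 2) ℂ},
      ContinuousOn (fun p : ℝ × ℝ => f p.1 p.2) TriD → ∀ x, 0 ≤ x →
      ContinuousOn (f x) (Ico 0 (1 - x)) := fun {f} hf x hx =>
    hf.comp (f := fun t : ℝ => (x, t)) (by fun_prop)
      fun t ht => ⟨hx, ht.1, by linarith [ht.2]⟩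
  have hVΦ : ∀ x, 0 ≤ x → ∀ t ∈ Ioo 0 (1 - x),
      Vmat E k x t * Φ x t = t ^ (-α) • (v x t * Φ x t) := by
    intro x hx t ht
    rw [hVv x t hx ht.1 (by linarith [ht.2]), smul_mul_assoc]
  have hUΦ : ∀ y, 0 ≤ y → ∀ t ∈ Ioo 0 (1 - y),
      Umat E k t y * Φ t y = t ^ (-α) • (u t y * Φ t y) := by
    intro y hy t ht
    rw [hUu t y ht.1 hy (by linarith [ht.2]), smul_mul_assoc]
  have hUΦint : ∀ y, 0 ≤ y → ∀ x ∈ Ico 0 (1 - y),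
      @IntervalIntegrable _ PseudoMetricSpace.toUniformSpace.toTopologicalSpace _
        (fun t => Umat E k t y * Φ t y) volume 0 x := fun y hy x hx =>
    intervalIntegrable_of_eq_rpow_smul hα ((horiz huc y hy).mul (horiz hΦc y hy)) (hUΦ y hy) hx
  have hΦy : ∀ x, 0 ≤ x → ∀ y ∈ Ico 0 (1 - x),
      Φ x y = Φ0 x + ∫ t in (0 : ℝ)..y, Vmat E k x t * Φ x t := by
    intro x hx y hy
    refine (Matrix.eq_add_intervalIntegral_iff ?_).mpr
      (hΦeq (x, y) ⟨hx, hy.1, by linarith [hy.2]⟩)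
    exact intervalIntegrable_of_eq_rpow_smul hα ((vert hvc x hx).mul (vert hΦc x hx)) (hVΦ x hx) hy
  have hΦd : ∀ x, 0 ≤ x → ∀ y ∈ Ioo 0 (1 - x), HasDerivAt (Φ x) (Vmat E k x y * Φ x y) y := by
    intro x hx y hy
    refine ((hasDerivAt_integral_of_eq_rpow_smul hα ((vert hvc x hx).mul (vert hΦc x hx))
      (hVΦ x hx) hy).const_add (Φ0 x)).congr_of_eventuallyEq ?_
    filter_upwards [Ioo_mem_nhds hy.1 hy.2] with s hs using hΦy x hx s ⟨hs.1.le, hs.2⟩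
  have hΦ0 : ∀ x, 0 ≤ x → x < 1 → Φ x 0 = Φ0 x := by
    intro x hx hx1
    simpa using hΦy x hx 0 ⟨le_rfl, by linarith⟩
  have hΦx0 : ∀ x, 0 ≤ x → x < 1 →
      Φ x 0 = 1 + ∫ t in (0 : ℝ)..x, Umat E k t 0 * Φ t 0 := by
    intro x hx hx1
    refine (Matrix.eq_add_intervalIntegral_iff
      (hUΦint 0 le_rfl x ⟨hx, by simpa using hx1⟩)).mpr fun i j => ?_
    rw [hΦ0 x hx hx1, hΦ0eq x ⟨hx, hx1⟩ i j]
    congr 1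
    refine intervalIntegral.integral_congr fun t ht => ?_
    rw [uIcc_of_le hx] at ht
    simp only [hΦ0 t ht.1 (ht.2.trans_lt hx1)]
  have hvert0 : ∀ {f : ℝ → ℝ → Matrix (Fin 2) (Fin 2) ℂ},
      ContinuousOn (fun p : ℝ × ℝ => f p.1 p.2) TriD → ContinuousOn (f 0) (Ico 0 1) := by
    intro f hf
    simpa using vert hf 0 le_rfl
  have hVΦ1 : ∀ t ∈ Ioo (0 : ℝ) 1, Vmat E k 0 t * Φ1 t = t ^ (-α) • (v 0 t * Φ1 t) := by
    intro t ht
    rw [hVv 0 t le_rfl ht.1 (by linarith [ht.2]), smul_mul_assoc]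
  have hΦ1y : ∀ y ∈ Ico (0 : ℝ) 1, Φ1 y = 1 + ∫ t in (0 : ℝ)..y, Vmat E k 0 t * Φ1 t := by
    intro y hy
    refine (Matrix.eq_add_intervalIntegral_iff ?_).mpr (hΦ1eq y hy)
    exact intervalIntegrable_of_eq_rpow_smul hα ((hvert0 hvc).mul hΦ1c) hVΦ1 hy
  have hΦ1d : ∀ y ∈ Ioo (0 : ℝ) 1, HasDerivAt Φ1 (Vmat E k 0 y * Φ1 y) y := by
    intro y hy
    refine ((hasDerivAt_integral_of_eq_rpow_smul hα ((hvert0 hvc).mul hΦ1c) hVΦ1 hy).const_add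
      1).congr_of_eventuallyEq ?_
    filter_upwards [Ioo_mem_nhds hy.1 hy.2] with s hs using hΦ1y s ⟨hs.1.le, hs.2⟩
  have hleft : EqOn (Φ 0) Φ1 (Ico 0 1) := by
    refine eqOn_of_hasDerivAt_rpow_smul hα (V := Vmat E k 0) (hvert0 hvc)
      (fun y hy => hVv 0 y le_rfl hy.1 (by linarith [hy.2])) (hvert0 hΦc) hΦ1c ?_
      (fun y hy => hΦd 0 le_rfl y (by simpa using hy)) hΦ1d
    rw [hΦx0 0 le_rfl one_pos, hΦ1y 0 ⟨le_rfl, one_pos⟩]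
    simp
  have hinner : ∀ a x y, 0 < a → a ≤ x → 0 ≤ y → x + y < 1 →
      Φ x y = Φ a y + ∫ t in a..x, Umat E k t y * Φ t y := by
    intro a x y ha hax hy hxy
    obtain ⟨Y, hY1, hY2⟩ := exists_between (show y < 1 - x by linarith)
    have hsub : Icc a x ×ˢ Icc 0 Y ⊆ TriD := fun p hp =>
      ⟨ha.le.trans hp.1.1, hp.2.1, by linarith [hp.1.2, hp.2.2]⟩
    have hpow : ContinuousOn (fun p : ℝ × ℝ => p.1 ^ (-α)) (Icc a x ×ˢ Icc 0 Y) :=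
      continuousOn_fst.rpow_const fun p hp => Or.inl (ha.trans_le hp.1.1).ne'
    have hlamx : ContinuousOn (fun p : ℝ × ℝ => -(1 / (2 * lam p.1 p.2 k * (k - (p.1 : ℂ)))))
        TriD := by
      refine (ContinuousOn.div (by fun_prop) (by fun_prop) fun p hp => ?_).neg
      exact mul_ne_zero (mul_ne_zero two_ne_zero (hlam0 p hp))
        (sub_ofReal_ne_zero_of_notMem_seg01 hk ⟨hp.1, by linarith [hp.2.1, hp.2.2]⟩)
    have hin : ∀ t ∈ Icc a x, ∀ s ∈ Ioo 0 Y, 0 < t ∧ 0 < s ∧ t + s < 1 := fun t ht s hs =>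
      ⟨ha.trans_le ht.1, hs.1, by linarith [ht.2, hs.2]⟩
    have hD : ∀ t ∈ Icc a x, ∀ s ∈ Ioo 0 Y, (t, s) ∈ TriD := fun t ht s hs =>
      hsub ⟨ht, Ioo_subset_Icc_self hs⟩
    refine eq_add_integral_of_zero_curvature (X := x) (Y := Y) hax hα (V := Vmat E k)
      (Vx := VmatX E k) (v := v)
      (vx := fun t s => laxMatDeriv (E t s).re (t ^ (-α) • g₁ (t, s)).re (g₂ (t, s))
        (t ^ (-α) • g₃ (t, s)) (lam t s k)⁻¹ (-(1 / (2 * lam t s k * (k - (t : ℂ))))))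
      (hΦc.mono hsub) ?_ (hvc.mono hsub) ?_ ?_ ?_ ?_ ?_ ?_ ?_ x (right_mem_Icc.mpr hax) y ⟨hy, hY1⟩
    · refine (hpow.smul (huc.mono hsub)).congr fun p hp => ?_
      exact hUu p.1 p.2 (ha.trans_le hp.1.1) hp.2.1 (hsub hp).2.2
    · exact continuousOn_laxMatDeriv (hre.mono hsub)
        (continuous_re.comp_continuousOn (hpow.smul (hg₁c.mono hsub))) (hg₂c.mono hsub)
        (hpow.smul (hg₃c.mono hsub)) ((hlam.inv₀ hlam0).mono hsub) (hlamx.mono hsub)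
        fun p hp => hre0 p (hsub hp)
    · intro t ht s hs
      obtain ⟨h1, h2, h3⟩ := hin t ht s hs
      exact hVv t s h1.le h2 h3
    · intro t ht s hs
      obtain ⟨h1, h2, h3⟩ := hin t ht s hs
      rw [VmatX, hpdx t s h1 h2.le h3, hpdy t s h1.le h2 h3, hpdxy t s h1 h2 h3, laxMatDeriv_smul]
    · intro t ht s hs
      obtain ⟨h1, h2, h3⟩ := hin t ht s hs
      exact hΦd t h1.le s ⟨h2, by linarith⟩
    · intro t ht s hs
      obtain ⟨h1, h2, h3⟩ := hin t ht s hs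
      exact hasDerivAt_Vmat hk (hD t ht s hs) (hpos _ (hD t ht s hs)) (hC2 t s h1 h2 h3)
    · intro t ht s hs
      obtain ⟨h1, h2, h3⟩ := hin t ht s hs
      exact hasDerivAt_Umat hk (hD t ht s hs) (hpos _ (hD t ht s hs)) (hC2 t s h1 h2 h3)
        (hErnst _ (mem_interior_TriD h1 h2 h3))
    · intro t ht
      have ht1 : t < 1 := by linarith [ht.2]
      have i1 := hUΦint 0 le_rfl a ⟨ha.le, by linarith [ht.1]⟩
      have i2 := hUΦint 0 le_rfl t ⟨(ha.trans_le ht.1).le, by linarith⟩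
      rw [hΦx0 t (ha.trans_le ht.1).le ht1, hΦx0 a ha.le (ht.1.trans_lt ht1), add_assoc,
        intervalIntegral.integral_add_adjacent_intervals i1 (i1.symm.trans i2)]
  rintro ⟨x, y⟩ ⟨hx, hy, hxy⟩
  simp only at hx hy hxy ⊢
  have hint := hUΦint y hy x ⟨hx, by linarith⟩
  refine (Matrix.eq_add_intervalIntegral_iff hint).mp ?_
  rw [← hleft ⟨hy, by linarith⟩]
  rcases hx.eq_or_lt with rfl | hx
  · simp
  have hprim : ContinuousOn (fun a => ∫ t in a..x, Umat E k t y * Φ t y) (uIcc 0 x) :=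
    intervalIntegral.continuousOn_primitive_interval_left
      ((intervalIntegrable_iff' (by finiteness)).mp hint)
  rw [uIcc_of_le hx.le] at hprim
  have hcont : ContinuousOn (fun a => Φ a y + ∫ t in a..x, Umat E k t y * Φ t y) (Icc 0 x) :=
    ((horiz hΦc y hy).mono fun t ht => ⟨ht.1, by linarith [ht.2]⟩).add hprim
  have hlim := ((hcont 0 (left_mem_Icc.mpr hx.le)).mono_of_mem_nhdsWithin
    (Icc_mem_nhdsGT hx)).tendsto
  refine tendsto_nhds_unique (tendsto_const_nhds.congr' ?_) hlim
  filter_upwards [Ioo_mem_nhdsGT hx] with a ha using hinner a x y ha.1 ha.2.le hy hxy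

end Lax

/-- The eigenfunction Φ defined via the y-Volterra equation (with initial
value Φ0 on the x-axis) also satisfies the alternative x-Volterra equation (with initial
value Φ1 on the y-axis). -/
theorem volterra_alternative_representation
    (n : ℕ) (hn : 2 ≤ n) (α : ℝ) (hα : α ∈ Ico (0:ℝ) 1)
    (E0 E1 : ℝ → ℂ) (hd0 : ErnstData n α E0) (hd1 : ErnstData n α E1)
    (E : ℝ → ℝ → ℂ) (hE : ErnstSolutionWith n α E E0 E1)
    (k : ℂ) (hk : k ∉ seg01)
    (Φ0 : ℝ → Matrix (Fin 2) (Fin 2) ℂ)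
    (hΦ0c : ContinuousOn Φ0 (Ico 0 1))
    (hΦ0eq : ∀ x ∈ Ico (0:ℝ) 1, ∀ i j, Φ0 x i j =
      (1 : Matrix (Fin 2) (Fin 2) ℂ) i j + ∫ t in (0:ℝ)..x, (Umat E k t 0 * Φ0 t) i j)
    (Φ1 : ℝ → Matrix (Fin 2) (Fin 2) ℂ)
    (hΦ1c : ContinuousOn Φ1 (Ico 0 1))
    (hΦ1eq : ∀ y ∈ Ico (0:ℝ) 1, ∀ i j, Φ1 y i j =
      (1 : Matrix (Fin 2) (Fin 2) ℂ) i j + ∫ t in (0:ℝ)..y, (Vmat E k 0 t * Φ1 t) i j)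
    (Φ : ℝ → ℝ → Matrix (Fin 2) (Fin 2) ℂ)
    (hΦc : ContinuousOn (fun p : ℝ × ℝ => Φ p.1 p.2) TriD)
    (hΦeq : ∀ p ∈ TriD, ∀ i j, Φ p.1 p.2 i j =
      Φ0 p.1 i j + ∫ t in (0:ℝ)..p.2, (Vmat E k p.1 t * Φ p.1 t) i j) :
    ∀ p ∈ TriD, ∀ i j, Φ p.1 p.2 i j =
      Φ1 p.2 i j + ∫ t in (0:ℝ)..p.1, (Umat E k t p.2 * Φ t p.2) i j := by
  exact eq_add_integral_Umat hn hα.2 hE hk hΦ0eq hΦ1c hΦ1eq hΦc hΦeq
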